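/- There is a constant C such that the following holds. Suppose a pure state ψ on registers Q₁A₁⋯Q_kA_k passes the uniformity test with parameters (K', Q, k, η) with probability 1 − ε > 0. Then there exists a collection 𝒮 of subsets of {1,…,k} such that (1) every T ∈ 𝒮 satisfies |T| ≥ (k/K')(1−η), and (2) the probability distribution μ_Q obtained by measuring all k question registers of ψ in the standard basis is within total variational distance δ(ε) ≤ C·ε^{1/4} of a distribution of the form Σ_{T∈𝒮} p(T) · μ^{unif}_T ⊗ μ^{junk}_{T̄}, where p is a probability distribution on 𝒮, μ^{unif}_T is the uniform distribution over [Q]^{|T|} on the coordinates in T, and μ^{junk}_{T̄} is some (arbitrary) distribution on the coordinates in {1,…,k}∖T. -/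

import Mathlib

open scoped BigOperators Classical

/-- Amplitude `⟨t | F_K | s⟩` of the quantum Fourier transform on `ℂ^K`. -/
noncomputable def fourierAmp (K : ℕ) (s t : ℕ) : ℂ :=
  Complex.exp (2 * Real.pi * Complex.I * s * t / K) / Real.sqrt K

/-- Overlap of ψ with the basis vector indexed by `(r, q̄)`, where the answer registers carry the
Fourier basis vector `r`, the question registers `i` with `r i = 0` carry the zero Fourier state
(`q̄ i` is forced to be `0` there), and the remaining question registers carry `|q̄ i⟩`. -/
noncomputable def unifOverlap (K' Q k : ℕ) (r : Fin k → Fin K') (qbar : Fin k → Fin Q)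
    (ψ : (Fin k → Fin Q) → (Fin k → Fin K') → ℂ) : ℂ :=
  ∑ q : Fin k → Fin Q, ∑ a : Fin k → Fin K',
    ψ q a * (∏ i, (starRingEnd ℂ) (fourierAmp K' (r i) (a i)))
      * (∏ i, if (r i : ℕ) = 0 then
            (starRingEnd ℂ) (fourierAmp Q 0 (q i)) * (if (qbar i : ℕ) = 0 then 1 else 0)
          else (if q i = qbar i then 1 else 0))

/-- Probability that ψ passes the uniformity test with parameters `(K', Q, k, η)`. -/
noncomputable def unifPassProb (K' Q k : ℕ) (η : ℝ)
    (ψ : (Fin k → Fin Q) → (Fin k → Fin K') → ℂ) : ℝ :=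
  ∑ r : Fin k → Fin K',
    if ((1 - η) / (K' : ℝ) * k ≤ ((Finset.univ.filter fun i => (r i : ℕ) = 0).card : ℝ)) then
      ∑ qbar : Fin k → Fin Q, Complex.normSq (unifOverlap K' Q k r qbar ψ)
    else 0

/-- The distribution obtained by measuring all question registers of ψ in the standard basis. -/
noncomputable def questionDist {K' Q k : ℕ}
    (ψ : (Fin k → Fin Q) → (Fin k → Fin K') → ℂ) (q : Fin k → Fin Q) : ℝ :=
  ∑ a : Fin k → Fin K', Complex.normSq (ψ q a)

open Finset ComplexConjugate

lemma fourierAmp_eq_pow (K s t : ℕ) :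
    fourierAmp K s t = Complex.exp (2 * Real.pi * Complex.I / K) ^ (s * t) / Real.sqrt K := by
  rw [fourierAmp, ← Complex.exp_nat_mul]
  congr 2
  push_cast
  ring

lemma fourierAmp_zero_left (K t : ℕ) : fourierAmp K 0 t = ((1 / Real.sqrt K : ℝ) : ℂ) := by
  simp [fourierAmp]

lemma sum_conj_fourierAmp_mul {K : ℕ} (hK : 0 < K) (a b : Fin K) :
    ∑ s : Fin K, conj (fourierAmp K s a) * fourierAmp K s b = if a = b then 1 else 0 := by
  have hζ := Complex.isPrimitiveRoot_exp K hK.ne'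
  set ζ := Complex.exp (2 * Real.pi * Complex.I / K) with hζdef
  have hnorm : conj ζ * ζ = 1 := by
    rw [mul_comm, Complex.mul_conj, Complex.normSq_eq_norm_sq, hζ.norm'_eq_one hK.ne']
    simp
  have hsq : ((Real.sqrt K : ℝ) : ℂ) * ((Real.sqrt K : ℝ) : ℂ) = K := by
    rw [← Complex.ofReal_mul, Real.mul_self_sqrt (Nat.cast_nonneg K), Complex.ofReal_natCast]
  have hterm : ∀ s : Fin K, conj (fourierAmp K s a) * fourierAmp K s b
      = (conj ζ ^ (a : ℕ) * ζ ^ (b : ℕ)) ^ (s : ℕ) / K := by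
    intro s
    rw [fourierAmp_eq_pow, fourierAmp_eq_pow, ← hζdef, map_div₀, map_pow, Complex.conj_ofReal,
      div_mul_div_comm, hsq, mul_pow, ← pow_mul, ← pow_mul, mul_comm (s : ℕ), mul_comm (s : ℕ)]
  have hK0 : (K : ℂ) ≠ 0 := by exact_mod_cast hK.ne'
  rw [sum_congr rfl fun s _ => hterm s, ← sum_div,
    Fin.sum_univ_eq_sum_range fun s => (conj ζ ^ (a : ℕ) * ζ ^ (b : ℕ)) ^ s]
  set w := conj ζ ^ (a : ℕ) * ζ ^ (b : ℕ) with hw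
  split_ifs with hab
  · have : w = 1 := by rw [hw, hab, ← mul_pow, hnorm, one_pow]
    simp [this, hK0]
  · have hw1 : w ≠ 1 := by
      intro h
      apply hab
      have : ζ ^ (a : ℕ) = ζ ^ (b : ℕ) := by
        calc ζ ^ (a : ℕ) = ζ ^ (a : ℕ) * w := by rw [h, mul_one]
          _ = (conj ζ * ζ) ^ (a : ℕ) * ζ ^ (b : ℕ) := by rw [hw, mul_pow]; ring
          _ = _ := by rw [hnorm, one_pow, one_mul]
      exact Fin.ext (hζ.pow_inj a.2 b.2 this)
    have hwK : w ^ K = 1 := by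
      rw [hw, mul_pow, ← pow_mul, ← pow_mul, mul_comm (a : ℕ), mul_comm (b : ℕ), pow_mul, pow_mul,
        ← map_pow, hζ.pow_eq_one]
      simp
    rw [geom_sum_eq hw1, hwK]
    simp

/-- The vector on the question registers left after projecting the answer registers of `ψ` onto
the Fourier basis vector `r`. -/
noncomputable def fourierSlice {K' Q k : ℕ} (ψ : (Fin k → Fin Q) → (Fin k → Fin K') → ℂ)
    (r : Fin k → Fin K') (q : Fin k → Fin Q) : ℂ :=
  ∑ a : Fin k → Fin K', ψ q a * ∏ i, conj (fourierAmp K' (r i) (a i))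

/-- Parseval's identity for the tensor power of the Fourier transform. -/
lemma sum_normSq_fourierSlice {K' Q k : ℕ} (hK : 0 < K')
    (ψ : (Fin k → Fin Q) → (Fin k → Fin K') → ℂ) (q : Fin k → Fin Q) :
    ∑ r, Complex.normSq (fourierSlice ψ r q) = questionDist ψ q := by
  have horth : ∀ a b : Fin k → Fin K',
      ∑ r : Fin k → Fin K', ∏ i, (conj (fourierAmp K' (r i) (a i)) * fourierAmp K' (r i) (b i))
        = if a = b then 1 else 0 := by
    intro a b
    rw [← Fintype.prod_sum fun i (s : Fin K') => conj (fourierAmp K' s (a i)) * fourierAmp K' s (b i)]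
    simp_rw [sum_conj_fourierAmp_mul hK, Finset.prod_ite_zero, funext_iff]
    simp
  apply Complex.ofReal_injective
  rw [questionDist]
  push_cast
  calc ∑ r, (Complex.normSq (fourierSlice ψ r q) : ℂ)
      = ∑ r : Fin k → Fin K', ∑ a, ∑ b, ψ q a * conj (ψ q b) *
          ∏ i, (conj (fourierAmp K' (r i) (a i)) * fourierAmp K' (r i) (b i)) := by
        refine sum_congr rfl fun r _ => ?_
        rw [← Complex.mul_conj, fourierSlice, map_sum, sum_mul_sum]
        refine sum_congr rfl fun a _ => sum_congr rfl fun b _ => ?_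
        rw [map_mul, map_prod, prod_mul_distrib]
        simp_rw [Complex.conj_conj]
        ring
    _ = ∑ a, ∑ b, ψ q a * conj (ψ q b) * (if a = b then 1 else 0) := by
        rw [sum_comm]
        refine sum_congr rfl fun a _ => ?_
        rw [sum_comm]
        refine sum_congr rfl fun b _ => ?_
        rw [← mul_sum, horth]
    _ = ∑ a, (Complex.normSq (ψ q a) : ℂ) := by
        simp [Complex.mul_conj]

/-- Overwrite the coordinates of `q` in `T` by zero. -/
def zeroOn {Q k : ℕ} (hQ : 0 < Q) (T : Finset (Fin k)) (q : Fin k → Fin Q) : Fin k → Fin Q :=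
  fun i => if i ∈ T then ⟨0, hQ⟩ else q i

lemma card_fiber_zeroOn {Q k : ℕ} (hQ : 0 < Q) (T : Finset (Fin k)) (q : Fin k → Fin Q) :
    #{q' | zeroOn hQ T q' = zeroOn hQ T q} = Q ^ #T := by
  have : ({q' | zeroOn hQ T q' = zeroOn hQ T q} : Finset (Fin k → Fin Q))
      = Fintype.piFinset fun i => if i ∈ T then univ else {q i} := by
    ext q'
    simp only [mem_filter, mem_univ, true_and, Fintype.mem_piFinset, funext_iff, zeroOn]
    refine forall_congr' fun i => ?_
    by_cases h : i ∈ T <;> simp [h]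
  rw [this, Fintype.card_piFinset]
  simp [apply_ite Finset.card]

/-- The set of registers on which the outcome `r` is zero. -/
def zeroSet {K' k : ℕ} (r : Fin k → Fin K') : Finset (Fin k) :=
  univ.filter fun i => (r i : ℕ) = 0

lemma unifOverlap_eq {K' Q k : ℕ} (hQ : 0 < Q) (ψ : (Fin k → Fin Q) → (Fin k → Fin K') → ℂ)
    (r : Fin k → Fin K') (b : Fin k → Fin Q) :
    unifOverlap K' Q k r b ψ = (((1 / Real.sqrt Q) ^ #(zeroSet r) : ℝ) : ℂ) *
      ∑ q with zeroOn hQ (zeroSet r) q = b, fourierSlice ψ r q := by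
  have hprod : ∀ q : Fin k → Fin Q, (∏ i, if (r i : ℕ) = 0 then
            conj (fourierAmp Q 0 (q i)) * (if (b i : ℕ) = 0 then 1 else 0)
          else (if q i = b i then 1 else 0))
      = (((1 / Real.sqrt Q) ^ #(zeroSet r) : ℝ) : ℂ) *
        if zeroOn hQ (zeroSet r) q = b then 1 else 0 := by
    intro q
    have hfac : ∀ i, (if (r i : ℕ) = 0 then
            conj (fourierAmp Q 0 (q i)) * (if (b i : ℕ) = 0 then 1 else 0)
          else (if q i = b i then 1 else 0))
        = (if (r i : ℕ) = 0 then ((1 / Real.sqrt Q : ℝ) : ℂ) else 1) *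
          if zeroOn hQ (zeroSet r) q i = b i then 1 else 0 := by
      intro i
      by_cases h : (r i : ℕ) = 0
      · simp [h, zeroOn, zeroSet, fourierAmp_zero_left, Fin.ext_iff, eq_comm]
      · simp [h, zeroOn, zeroSet]
    rw [prod_congr rfl fun i _ => hfac i, prod_mul_distrib, Finset.prod_ite_zero, prod_ite]
    simp [zeroSet, funext_iff]
  rw [unifOverlap, sum_filter, mul_sum]
  refine sum_congr rfl fun q _ => ?_
  simp_rw [hprod]
  rw [← sum_mul, fourierSlice]
  split_ifs <;> simp [mul_comm]

section FiberAverage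

variable {α : Type*} [Fintype α] [DecidableEq α]

lemma sum_normSq_fiberAverage (m : α → α) (c : ℝ) (hc : ∀ a, c ^ 2 * #{a' | m a' = m a} = 1)
    (φ O : α → ℂ) (hO : ∀ b, O b = c * ∑ a with m a = b, φ a) :
    ∑ a, Complex.normSq (c * O (m a)) = ∑ b, Complex.normSq (O b) := by
  rw [← sum_fiberwise univ m]
  refine sum_congr rfl fun b _ => ?_
  by_cases hb : ∃ a, m a = b
  · obtain ⟨a, rfl⟩ := hb
    rw [sum_congr rfl (g := fun _ => c ^ 2 * Complex.normSq (O (m a))), sum_const, nsmul_eq_mul]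
    · linear_combination Complex.normSq (O (m a)) * hc a
    · intro a' ha'
      rw [(mem_filter.mp ha').2, map_mul, Complex.normSq_ofReal, sq]
  · have hemp : ({a | m a = b} : Finset α) = ∅ := by
      ext a
      simpa using fun h => hb ⟨a, h⟩
    simp [hO, hemp]

lemma sum_normSq_sub_fiberAverage (m : α → α) (c : ℝ)
    (hc : ∀ a, c ^ 2 * #{a' | m a' = m a} = 1)
    (φ O : α → ℂ) (hO : ∀ b, O b = c * ∑ a with m a = b, φ a) :
    ∑ a, Complex.normSq (φ a - c * O (m a))
      = ∑ a, Complex.normSq (φ a) - ∑ b, Complex.normSq (O b) := by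
  have hcross : ∑ a, φ a * conj (c * O (m a)) = ∑ b, (Complex.normSq (O b) : ℂ) := by
    rw [← sum_fiberwise univ m]
    refine sum_congr rfl fun b _ => ?_
    rw [← Complex.mul_conj]
    nth_rw 1 [hO b]
    rw [mul_assoc, sum_mul, mul_sum]
    refine sum_congr rfl fun a ha => ?_
    rw [(mem_filter.mp ha).2, map_mul, Complex.conj_ofReal]
    ring
  have hre : ∑ a, (φ a * conj (c * O (m a))).re = ∑ b, Complex.normSq (O b) := by
    rw [← Complex.re_sum, hcross, ← Complex.ofReal_sum, Complex.ofReal_re]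
  simp_rw [Complex.normSq_sub]
  rw [sum_sub_distrib, sum_add_distrib, ← mul_sum, hre, sum_normSq_fiberAverage m c hc φ O hO]
  ring

end FiberAverage

lemma sum_abs_normSq_sub_le {ι : Type*} (s : Finset ι) (u v : ι → ℂ)
    (hu : ∑ i ∈ s, Complex.normSq (u i) ≤ 1) (hv : ∑ i ∈ s, Complex.normSq (v i) ≤ 1) :
    ∑ i ∈ s, |Complex.normSq (u i) - Complex.normSq (v i)|
      ≤ 2 * Real.sqrt (∑ i ∈ s, Complex.normSq (u i - v i)) := by
  simp_rw [Complex.normSq_eq_norm_sq] at *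
  have h4 : ∑ i ∈ s, (‖u i‖ + ‖v i‖) ^ 2 ≤ 2 ^ 2 := by
    calc ∑ i ∈ s, (‖u i‖ + ‖v i‖) ^ 2 ≤ ∑ i ∈ s, (2 * ‖u i‖ ^ 2 + 2 * ‖v i‖ ^ 2) :=
          sum_le_sum fun i _ => by nlinarith [sq_nonneg (‖u i‖ - ‖v i‖)]
      _ ≤ 2 ^ 2 := by
          rw [sum_add_distrib, ← mul_sum, ← mul_sum]
          linarith
  calc ∑ i ∈ s, |‖u i‖ ^ 2 - ‖v i‖ ^ 2|
      ≤ ∑ i ∈ s, (‖u i‖ + ‖v i‖) * ‖u i - v i‖ := by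
        refine sum_le_sum fun i _ => ?_
        rw [sq_sub_sq, abs_mul, abs_of_nonneg (by positivity : 0 ≤ ‖u i‖ + ‖v i‖)]
        exact mul_le_mul_of_nonneg_left (abs_norm_sub_norm_le _ _) (by positivity)
    _ ≤ Real.sqrt (∑ i ∈ s, (‖u i‖ + ‖v i‖) ^ 2) * Real.sqrt (∑ i ∈ s, ‖u i - v i‖ ^ 2) :=
        Real.sum_mul_le_sqrt_mul_sqrt _ _ _
    _ ≤ 2 * Real.sqrt (∑ i ∈ s, ‖u i - v i‖ ^ 2) := by
        gcongr
        exact Real.sqrt_le_iff.mpr ⟨by norm_num, h4⟩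

/-- There is a constant `C` such that if a pure state ψ passes the uniformity
test with probability `1 - ε > 0`, then the standard-basis distribution on its question registers
is within total variational distance `C · ε^{1/4}` of a mixture, over large subsets `T ⊆ [k]`
with `|T| ≥ (k/K')(1-η)`, of (uniform on `T`) ⊗ (arbitrary junk on the complement). -/
theorem uniformity_test_soundness :
    ∃ C : ℝ, 0 < C ∧
      ∀ (K' Q k : ℕ), 0 < K' → 0 < Q →
      ∀ (η : ℝ), 0 < η → η < 1 →
      ∀ (ψ : (Fin k → Fin Q) → (Fin k → Fin K') → ℂ),
        (∑ q : Fin k → Fin Q, ∑ a : Fin k → Fin K', Complex.normSq (ψ q a) = 1) →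
      ∀ (ε : ℝ), 0 ≤ ε → ε < 1 →
        unifPassProb K' Q k η ψ = 1 - ε →
        ∃ (S : Finset (Finset (Fin k))) (p : Finset (Fin k) → ℝ)
          (g : Finset (Fin k) → (Fin k → Fin Q) → ℝ),
          (∀ T ∈ S, ((k : ℝ) / (K' : ℝ)) * (1 - η) ≤ (T.card : ℝ)) ∧
          (∀ T ∈ S, 0 ≤ p T) ∧
          (∑ T ∈ S, p T = 1) ∧
          (∀ T ∈ S, ∀ q, 0 ≤ g T q) ∧
          (∀ T ∈ S, ∀ q q' : Fin k → Fin Q, (∀ i, i ∉ T → q i = q' i) → g T q = g T q') ∧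
          (∀ T ∈ S, ∑ q : Fin k → Fin Q, (1 / (Q : ℝ)) ^ T.card * g T q = 1) ∧
          (1 / 2) * ∑ q : Fin k → Fin Q,
              |questionDist ψ q - ∑ T ∈ S, p T * ((1 / (Q : ℝ)) ^ T.card * g T q)|
            ≤ C * ε ^ ((1 : ℝ) / 4) := by
  refine ⟨2, by norm_num, ?_⟩
  intro K' Q k hK hQ η _ _ ψ hψ ε hε0 hε1 hpass
  set good : (Fin k → Fin K') → Prop := fun r => (1 - η) / (K' : ℝ) * k ≤ (#(zeroSet r) : ℝ)
  set O : (Fin k → Fin K') → (Fin k → Fin Q) → ℂ := fun r b => unifOverlap K' Q k r b ψ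
  set c : Finset (Fin k) → ℝ := fun T => (1 / Real.sqrt Q) ^ #T with hc
  have hQ' : (0 : ℝ) < Q := by exact_mod_cast hQ
  have hcsq : ∀ T, c T ^ 2 = (1 / (Q : ℝ)) ^ #T := by
    intro T
    rw [hc, ← pow_mul, mul_comm, pow_mul, div_pow, Real.sq_sqrt hQ'.le, one_pow]
  have hcard : ∀ T q, c T ^ 2 * (#{q' | zeroOn hQ T q' = zeroOn hQ T q} : ℝ) = 1 := by
    intro T q
    rw [card_fiber_zeroOn, hcsq, Nat.cast_pow, ← mul_pow, one_div_mul_cancel hQ'.ne', one_pow]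
  -- the component of the state that passes the test
  set X : (Fin k → Fin K') → (Fin k → Fin Q) → ℂ := fun r q =>
    if good r then c (zeroSet r) * O r (zeroOn hQ (zeroSet r) q) else 0 with hX
  have hpass' : ∑ r, (if good r then ∑ b, Complex.normSq (O r b) else 0) = 1 - ε := hpass
  have hXsum : ∑ r, ∑ q, Complex.normSq (X r q) = 1 - ε := by
    rw [← hpass']
    refine sum_congr rfl fun r _ => ?_
    by_cases h : good r
    · simp only [hX, if_pos h]
      exact sum_normSq_fiberAverage (zeroOn hQ (zeroSet r)) (c (zeroSet r)) (hcard _)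
        (fourierSlice ψ r) (O r) fun b => unifOverlap_eq hQ ψ r b
    · simp [hX, h]
  have hφsum : ∑ r, ∑ q, Complex.normSq (fourierSlice ψ r q) = 1 := by
    rw [sum_comm, ← hψ]
    exact sum_congr rfl fun q _ => sum_normSq_fourierSlice hK ψ q
  have hdiff : ∑ r, ∑ q, Complex.normSq (fourierSlice ψ r q - X r q) = ε := by
    have : ε = ∑ r, (∑ q, Complex.normSq (fourierSlice ψ r q)
        - if good r then ∑ b, Complex.normSq (O r b) else 0) := by
      rw [sum_sub_distrib, hφsum, hpass']
      ring
    rw [this]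
    refine sum_congr rfl fun r _ => ?_
    by_cases h : good r
    · simp only [hX, if_pos h]
      exact sum_normSq_sub_fiberAverage (zeroOn hQ (zeroSet r)) (c (zeroSet r)) (hcard _)
        (fourierSlice ψ r) (O r) fun b => unifOverlap_eq hQ ψ r b
    · simp [hX, h]
  have h1ε : 0 < 1 - ε := by linarith
  set W : Finset (Fin k) → (Fin k → Fin Q) → ℝ := fun T q =>
    ∑ r with zeroSet r = T, Complex.normSq (X r q) with hW
  have hW0 : ∀ T q, 0 ≤ W T q := fun T q => sum_nonneg fun _ _ => Complex.normSq_nonneg _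
  set S : Finset (Finset (Fin k)) := {T | 0 < ∑ q, W T q} with hS
  have hWS : ∀ T ∉ S, ∀ q, W T q = 0 := by
    intro T hT q
    have hle : ∑ q, W T q ≤ 0 := by simpa [hS] using hT
    exact (sum_eq_zero_iff_of_nonneg fun q _ => hW0 T q).mp
      (le_antisymm hle (sum_nonneg fun q _ => hW0 T q)) q (mem_univ q)
  have hWsum : ∀ q, ∑ T ∈ S, W T q = ∑ r, Complex.normSq (X r q) := by
    intro q
    rw [sum_subset (subset_univ S) fun T _ hT => hWS T hT q, hW]
    exact sum_fiberwise univ zeroSet fun r => Complex.normSq (X r q)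
  have hWtot : ∑ T ∈ S, ∑ q, W T q = 1 - ε := by
    rw [sum_comm, sum_congr rfl fun q _ => hWsum q, sum_comm, hXsum]
  have hmix : ∀ T ∈ S, ∀ q, (∑ q, W T q) / (1 - ε) * ((1 / (Q : ℝ)) ^ #T *
      (W T q * (Q : ℝ) ^ #T / ∑ q, W T q)) = W T q / (1 - ε) := by
    intro T hT q
    have hpos : 0 < ∑ q, W T q := by simpa [hS] using hT
    rw [one_div, inv_pow]
    field_simp
  refine ⟨S, fun T => (∑ q, W T q) / (1 - ε),
    fun T q => W T q * (Q : ℝ) ^ #T / ∑ q, W T q, ?_, ?_, ?_, ?_, ?_, ?_, ?_⟩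
  · intro T hT
    have hpos : 0 < ∑ q, W T q := by simpa [hS] using hT
    by_contra hlt
    refine hpos.ne' (sum_eq_zero fun q _ => sum_eq_zero fun r hr => ?_)
    have hbad : ¬ good r := by
      intro h
      apply hlt
      rw [← (mem_filter.mp hr).2]
      calc (k : ℝ) / K' * (1 - η) = (1 - η) / K' * k := by ring
        _ ≤ _ := h
    simp [hX, hbad]
  · exact fun T _ => div_nonneg (sum_nonneg fun q _ => hW0 T q) h1ε.le
  · rw [← sum_div, hWtot, div_self h1ε.ne']
  · exact fun T _ q => div_nonneg (mul_nonneg (hW0 T q) (by positivity))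
      (sum_nonneg fun q _ => hW0 T q)
  · intro T _ q q' hqq
    have : W T q = W T q' := by
      refine sum_congr rfl fun r hr => ?_
      have hz : zeroOn hQ (zeroSet r) q = zeroOn hQ (zeroSet r) q' := by
        rw [(mem_filter.mp hr).2]
        funext i
        by_cases h : i ∈ T
        · simp [zeroOn, h]
        · simp [zeroOn, h, hqq i h]
      simp only [hX, hz]
    simp only [this]
  · intro T hT
    have hpos : 0 < ∑ q, W T q := by simpa [hS] using hT
    rw [← mul_sum, ← sum_div, ← sum_mul, one_div, inv_pow]
    field_simp
  · have hεle : ε ≤ Real.sqrt ε := Real.le_sqrt_of_sq_le (by nlinarith)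
    have hsqrt : Real.sqrt ε ≤ ε ^ ((1 : ℝ) / 4) := by
      rw [Real.sqrt_eq_rpow]
      exact Real.rpow_le_rpow_of_exponent_ge' hε0 hε1.le (by norm_num) (by norm_num)
    have hclose : ∑ q, |questionDist ψ q - ∑ r, Complex.normSq (X r q)| ≤ 2 * Real.sqrt ε := by
      calc ∑ q, |questionDist ψ q - ∑ r, Complex.normSq (X r q)|
          ≤ ∑ q, ∑ r, |Complex.normSq (fourierSlice ψ r q) - Complex.normSq (X r q)| := by
            refine sum_le_sum fun q _ => ?_
            rw [← sum_normSq_fourierSlice hK ψ q, ← sum_sub_distrib]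
            exact abs_sum_le_sum_abs _ _
        _ = ∑ x : (Fin k → Fin K') × (Fin k → Fin Q),
              |Complex.normSq (fourierSlice ψ x.1 x.2) - Complex.normSq (X x.1 x.2)| := by
            rw [sum_comm, Fintype.sum_prod_type]
        _ ≤ 2 * Real.sqrt (∑ x : (Fin k → Fin K') × (Fin k → Fin Q),
              Complex.normSq (fourierSlice ψ x.1 x.2 - X x.1 x.2)) := by
            apply sum_abs_normSq_sub_le
            · rw [Fintype.sum_prod_type, hφsum]
            · rw [Fintype.sum_prod_type, hXsum]
              linarith
        _ = 2 * Real.sqrt ε := by rw [Fintype.sum_prod_type, hdiff]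
    have hnormalize : ∑ q, |∑ r, Complex.normSq (X r q) - (∑ r, Complex.normSq (X r q)) / (1 - ε)|
        = ε := by
      have hterm : ∀ q, |∑ r, Complex.normSq (X r q) - (∑ r, Complex.normSq (X r q)) / (1 - ε)|
          = (∑ r, Complex.normSq (X r q)) * (ε / (1 - ε)) := by
        intro q
        have hnn : 0 ≤ ∑ r, Complex.normSq (X r q) :=
          sum_nonneg fun _ _ => Complex.normSq_nonneg _
        rw [abs_sub_comm, ← abs_of_nonneg (mul_nonneg hnn (div_nonneg hε0 h1ε.le))]
        congr 1
        field_simp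
        ring
      rw [sum_congr rfl fun q _ => hterm q, ← sum_mul, sum_comm, hXsum,
        mul_div_cancel₀ _ h1ε.ne']
    have htotal : ∑ q, |questionDist ψ q - (∑ r, Complex.normSq (X r q)) / (1 - ε)|
        ≤ 2 * Real.sqrt ε + ε := by
      refine le_trans ?_ (add_le_add hclose hnormalize.le)
      rw [← sum_add_distrib]
      exact sum_le_sum fun q _ => abs_sub_le _ _ _
    have hrewrite : ∀ q, ∑ T ∈ S, (∑ q, W T q) / (1 - ε) * ((1 / (Q : ℝ)) ^ #T *
        (W T q * (Q : ℝ) ^ #T / ∑ q, W T q)) = (∑ r, Complex.normSq (X r q)) / (1 - ε) := by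
      intro q
      rw [sum_congr rfl fun T hT => hmix T hT q, ← sum_div, hWsum]
    simp only [hrewrite]
    linarith
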